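/- Let S be a nonempty finite subset of Fin N with |S| = m. Then ξ₂(S) ≤ B(m) ≤ r·(N/m + m − 1), i.e., ‖(P_S + μL)⁻¹ * P_S‖_F² ≤ r·(N/m) + ∑_{i=2}^{m} ω(max(1, λ_{N+2−i}/λᵢ)) ≤ r·(N/m + m − 1), for every μ > 0. -/

import Mathlib

open Matrix

/-- Squared Frobenius norm `‖A‖_F² = trace(Aᵀ A)`. -/
noncomputable def frobSq {m n : Type*} [Fintype m] [Fintype n] (A : Matrix m n ℝ) : ℝ :=
  Matrix.trace (Aᵀ * A)

/-- `ω(x) = (√x + 1/√x)²/4`, from the Kantorovich inequality. -/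
noncomputable def omegaFn (x : ℝ) : ℝ := (Real.sqrt x + 1 / Real.sqrt x) ^ 2 / 4

/-- The `j`-th eigenvalue `λⱼ` of the Laplacian, 1-indexed (with `λⱼ = 0` for `j ≤ 0` since
`λ₁ = 0`, and `0` beyond `N`). -/
noncomputable def eig1 {N : ℕ} (lam : Fin N → ℝ) (j : ℕ) : ℝ :=
  if h : j - 1 < N then lam ⟨j - 1, h⟩ else 0

/-- The bound `B(m) = r·(N/m) + ∑_{i=2}^{m} ω(max(1, λ_{N+2−i}/λᵢ))` where `r = ω(λ_N/λ₂)`. -/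
noncomputable def Bfull {N : ℕ} (lam : Fin N → ℝ) (m : ℕ) : ℝ :=
  omegaFn (eig1 lam N / eig1 lam 2) * ((N : ℝ) / (m : ℝ)) +
    ∑ i ∈ Finset.Icc 2 m, omegaFn (max 1 (eig1 lam (N + 2 - i) / eig1 lam i))

lemma exK {ι : Type*} [Fintype ι] [DecidableEq ι] (D Q : Matrix ι ι ℝ) (hD : Dᵀ = D)
    (hQ : Qᵀ = Q) (hQQ : Q * Q = Q)
    (hpos : ∀ v : ι → ℝ, Q *ᵥ v = v → v ⬝ᵥ D *ᵥ v = 0 → v = 0) :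
    ∃ K : Matrix ι ι ℝ, Kᵀ = K ∧ Q * K = K ∧ K * Q = K ∧ K * D * Q = Q ∧ Q * D * K = Q := by
  set C := Q * D * Q + (1 - Q) with hC
  have hCT : Cᵀ = C := by
    simp [hC, hD, hQ, Matrix.mul_assoc]
  have hQC : Q * C = Q * D * Q := by
    rw [hC, mul_add, mul_sub, mul_one, hQQ, sub_self, add_zero, ← mul_assoc, ← mul_assoc, hQQ]
  have hCQ : C * Q = Q * D * Q := by
    rw [hC, add_mul, sub_mul, one_mul, hQQ, sub_self, add_zero, mul_assoc, hQQ]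
  have hU : IsUnit C := by
    rw [← Matrix.mulVec_injective_iff_isUnit]
    rw [← Matrix.coe_mulVecLin, injective_iff_map_eq_zero]
    intro v hv
    rw [Matrix.mulVecLin_apply] at hv
    have h1 : (Q * D * Q) *ᵥ v = 0 := by
      rw [← hQC, ← Matrix.mulVec_mulVec, hv, Matrix.mulVec_zero]
    have h2 : Q *ᵥ v = v := by
      have := hv
      rw [hC, Matrix.add_mulVec, h1, zero_add, Matrix.sub_mulVec, Matrix.one_mulVec] at this
      exact (sub_eq_zero.1 this).symm
    apply hpos v h2
    rw [mul_assoc, ← Matrix.mulVec_mulVec, ← Matrix.mulVec_mulVec, h2] at h1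
    calc v ⬝ᵥ D *ᵥ v = (Q *ᵥ v) ⬝ᵥ D *ᵥ v := by rw [h2]
      _ = v ⬝ᵥ Q *ᵥ (D *ᵥ v) := by
        rw [Matrix.dotProduct_mulVec v Q, ← Matrix.mulVec_transpose, hQ]
      _ = 0 := by rw [h1, dotProduct_zero]
  have hdet : IsUnit C.det := (Matrix.isUnit_iff_isUnit_det C).1 hU
  have e1 : Q * C⁻¹ * Q * D * Q = Q := by
    calc Q * C⁻¹ * Q * D * Q = Q * C⁻¹ * (Q * D * Q) := by simp only [mul_assoc]
      _ = Q * (C⁻¹ * C) * Q := by rw [← hCQ]; simp only [mul_assoc]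
      _ = Q := by rw [Matrix.nonsing_inv_mul _ hdet, mul_one, hQQ]
  have eT : (Q * C⁻¹ * Q)ᵀ = Q * C⁻¹ * Q := by
    simp only [Matrix.transpose_mul, Matrix.transpose_nonsing_inv, hCT, hQ, mul_assoc]
  refine ⟨Q * C⁻¹ * Q, eT, ?_, ?_, e1, ?_⟩
  · simp only [← mul_assoc, hQQ]
  · simp only [mul_assoc, hQQ]
  · have := congrArg Matrix.transpose e1
    rw [Matrix.transpose_mul, Matrix.transpose_mul, eT, hD, hQ, ← mul_assoc] at this
    exact this

lemma exProj {n : ℕ} (M : Matrix (Fin n) (Fin n) ℝ) :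
    ∃ Q C : Matrix (Fin n) (Fin n) ℝ, Qᵀ = Q ∧ Q * Q = Q ∧ Q * M = M ∧ Q = M * C := by
  have hH : (M * Mᵀ).IsHermitian := by
    simpa using Matrix.isHermitian_mul_conjTranspose_self M
  set U : Matrix (Fin n) (Fin n) ℝ := (hH.eigenvectorUnitary : Matrix (Fin n) (Fin n) ℝ) with hUdef
  set e := hH.eigenvalues with he
  have hUU : Uᵀ * U = 1 := by
    have := (Matrix.mem_unitaryGroup_iff'.1 hH.eigenvectorUnitary.2)
    simpa [Matrix.star_eq_conjTranspose] using this
  have hUU' : U * Uᵀ = 1 := mul_eq_one_comm.1 hUU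
  have hs : M * Mᵀ = U * diagonal e * Uᵀ := by
    have := hH.spectral_theorem
    simpa [Unitary.conjStarAlgAut_apply, Matrix.star_eq_conjTranspose, Function.comp_def] using this
  set Q := U * diagonal (fun i => if e i = 0 then 0 else 1) * Uᵀ with hQ
  have hcomb : ∀ f g : Fin n → ℝ, U * diagonal f * Uᵀ * (U * diagonal g * Uᵀ) =
      U * diagonal (fun i => f i * g i) * Uᵀ := by
    intro f g
    calc _ = U * diagonal f * (Uᵀ * U) * diagonal g * Uᵀ := by simp only [mul_assoc]
      _ = _ := by rw [hUU, mul_one, mul_assoc U, diagonal_mul_diagonal]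
  have hQT : Qᵀ = Q := by simp [hQ, Matrix.transpose_mul, mul_assoc]
  have hQM : (1 - Q) * (M * Mᵀ) = 0 := by
    rw [sub_mul, one_mul, hs, hQ, hcomb, sub_eq_zero]
    congr 3; funext i; by_cases h : e i = 0 <;> simp [h]
  refine ⟨Q, Mᵀ * (U * diagonal (fun i => (e i)⁻¹) * Uᵀ), hQT, ?_, ?_, ?_⟩
  · rw [hQ, hcomb]; congr 3; funext i; by_cases h : e i = 0 <;> simp [h]
  · have h2 : ((1 - Q) * M) * ((1 - Q) * M)ᴴ = 0 := by
      rw [Matrix.conjTranspose_mul, ← mul_assoc, mul_assoc _ M]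
      have : Mᴴ = Mᵀ := by simp
      rw [this, hQM, zero_mul]
    have := Matrix.self_mul_conjTranspose_eq_zero.1 h2
    rw [sub_mul, one_mul, sub_eq_zero] at this
    exact this.symm
  · rw [← mul_assoc, hs, hcomb, hQ]; congr 3; funext i; by_cases h : e i = 0 <;> simp [h]

lemma trace_eq_rank {n : ℕ} (Q : Matrix (Fin n) (Fin n) ℝ) (hQQ : Q * Q = Q) :
    Q.trace = Q.rank := by
  have h : LinearMap.IsProj (LinearMap.range Q.mulVecLin) (Matrix.toLin' Q) := by
    constructor
    · intro x; exact ⟨x, rfl⟩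
    · rintro x ⟨y, rfl⟩
      simp [Matrix.toLin'_apply, Matrix.mulVec_mulVec, hQQ]
  have h2 := h.trace
  rw [Matrix.trace_toLin'_eq] at h2
  exact h2

lemma tele (n : ℕ) (x : ℕ → ℝ) (b : ℕ) (hb : b < n) :
    x b = x 0 + ∑ g ∈ Finset.range (n - 1), (x (g + 1) - x g) * (if g < b then 1 else 0) := by
  have : ∑ g ∈ Finset.range (n - 1), (x (g + 1) - x g) * (if g < b then 1 else 0)
      = ∑ g ∈ Finset.range b, (x (g + 1) - x g) := by
    simp only [mul_ite, mul_one, mul_zero]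
    rw [← Finset.sum_filter]
    congr 1
    ext g; simp; omega
  rw [this, Finset.sum_range_sub]; ring

def cfun (g h a b : ℕ) : ℝ :=
  ((if g < b then 1 else 0) - (if g < a then 1 else 0)) *
    ((if h < b then 1 else 0) - (if h < a then 1 else 0))

lemma cfun_swap (g h a b : ℕ) : cfun g h a b = cfun h g a b := by
  unfold cfun; ring

lemma cfun_eq (g h a b : ℕ) (hgh : g ≤ h) :
    cfun g h a b = (if a ≤ g ∧ h < b then 1 else 0) + (if b ≤ g ∧ h < a then 1 else 0) := by
  unfold cfun
  split_ifs <;> first | (exfalso; omega) | norm_num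

lemma prod_expand (n : ℕ) (x y : ℕ → ℝ) (a b : ℕ) (ha : a < n) (hb : b < n) :
    (x b - x a) * (y a - y b) = ∑ g ∈ Finset.range (n - 1), ∑ h ∈ Finset.range (n - 1),
      (x (g + 1) - x g) * (y h - y (h + 1)) * cfun g h a b := by
  rw [tele n x b hb, tele n x a ha, tele n y b hb, tele n y a ha]
  have e1 : ∀ X A B : ℝ, X + A - (X + B) = A - B := by intros; ring
  rw [e1, e1, ← Finset.sum_sub_distrib, ← Finset.sum_sub_distrib, Finset.sum_mul_sum]
  refine Finset.sum_congr rfl fun g _ => Finset.sum_congr rfl fun h _ => ?_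
  unfold cfun; ring

lemma lp_count (n k : ℕ) (hk : k ≤ n) (D : Fin n → Fin n → ℝ) (h0 : ∀ a b, 0 ≤ D a b)
    (hs : ∀ a b, D a b = D b a) (hr : ∀ a, ∑ b, D a b ≤ 1) (ht : ∑ a, ∑ b, D a b ≤ 2 * k)
    (g h : ℕ) (hgh : g ≤ h) (hh : h < n - 1) :
    ∑ a : Fin n, ∑ b : Fin n, D a b * cfun g h a b ≤
      2 * ∑ j ∈ Finset.range k, (if j < n - 1 - j then cfun g h j (n - 1 - j) else 0) := by
  set J : ℝ := ∑ a : Fin n, ∑ b : Fin n, D a b * (if (a : ℕ) ≤ g ∧ h < (b : ℕ) then 1 else 0) with hJ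
  have hJ' : J = ∑ a : Fin n, ∑ b : Fin n, D a b * (if (b : ℕ) ≤ g ∧ h < (a : ℕ) then 1 else 0) := by
    rw [hJ, Finset.sum_comm]
    refine Finset.sum_congr rfl fun a _ => Finset.sum_congr rfl fun b _ => ?_
    rw [hs]
  have hL : ∑ a : Fin n, ∑ b : Fin n, D a b * cfun g h a b = 2 * J := by
    rw [two_mul]; nth_rewrite 2 [hJ']; rw [hJ, ← Finset.sum_add_distrib]
    refine Finset.sum_congr rfl fun a _ => ?_
    rw [← Finset.sum_add_distrib]
    refine Finset.sum_congr rfl fun b _ => ?_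
    rw [cfun_eq _ _ _ _ hgh]; ring
  have b1 : J ≤ k := by
    have : 2 * J ≤ ∑ a, ∑ b, D a b := by
      rw [← hL]
      refine Finset.sum_le_sum fun a _ => Finset.sum_le_sum fun b _ => ?_
      rw [cfun_eq _ _ _ _ hgh]
      have := h0 a b
      split_ifs <;> first | (exfalso; omega) | linarith
    linarith
  have b2 : J ≤ (g + 1 : ℕ) := by
    have : J ≤ ∑ a : Fin n, (if (a : ℕ) ≤ g then (1 : ℝ) else 0) := by
      refine Finset.sum_le_sum fun a _ => ?_
      split_ifs with hag
      · refine le_trans (Finset.sum_le_sum fun b _ => ?_) (hr a)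
        have := h0 a b
        split_ifs <;> linarith
      · refine le_of_eq (Finset.sum_eq_zero fun b _ => ?_)
        simp [hag]
    refine this.trans (le_of_eq ?_)
    rw [Fin.sum_univ_eq_sum_range (fun a => if a ≤ g then (1 : ℝ) else 0) n, ← Finset.sum_filter]
    have : Finset.filter (fun a => a ≤ g) (Finset.range n) = Finset.range (g + 1) := by
      ext; simp; omega
    rw [this]; simp
  have b3 : J ≤ (n - 1 - h : ℕ) := by
    have : J ≤ ∑ a : Fin n, (if h < (a : ℕ) then (1 : ℝ) else 0) := by
      rw [hJ']
      refine Finset.sum_le_sum fun a _ => ?_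
      split_ifs with hag
      · refine le_trans (Finset.sum_le_sum fun b _ => ?_) (hr a)
        have := h0 a b
        split_ifs <;> linarith
      · refine le_of_eq (Finset.sum_eq_zero fun b _ => ?_)
        simp [hag]
    refine this.trans (le_of_eq ?_)
    rw [Fin.sum_univ_eq_sum_range (fun a => if h < a then (1 : ℝ) else 0) n, ← Finset.sum_filter]
    have : Finset.filter (fun a => h < a) (Finset.range n) = Finset.Ico (h + 1) n := by
      ext; simp; omega
    rw [this, Finset.sum_const, Nat.card_Ico, nsmul_eq_mul, mul_one]; congr 1; omega
  rw [hL]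
  set w := min k (min (g + 1) (n - 1 - h)) with hw
  have hJw : J ≤ (w : ℕ) := by
    rcases min_choice k (min (g + 1) (n - 1 - h)) with hc | hc
    · rw [hw, hc]; exact b1
    · rcases min_choice (g + 1) (n - 1 - h) with hc' | hc'
      · rw [hw, hc, hc']; exact b2
      · rw [hw, hc, hc']; exact b3
  have : (w : ℝ) ≤ ∑ j ∈ Finset.range k, (if j < n - 1 - j then cfun g h j (n - 1 - j) else 0) := by
    calc (w : ℝ) = ∑ j ∈ Finset.range w, (1 : ℝ) := by simp
      _ ≤ ∑ j ∈ Finset.range w, (if j < n - 1 - j then cfun g h j (n - 1 - j) else 0) := by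
        refine Finset.sum_le_sum fun j hj => ?_
        have hj' := Finset.mem_range.1 hj
        have : j < n - 1 - j := by omega
        rw [if_pos this, cfun_eq _ _ _ _ hgh, if_pos (by omega), if_neg (by omega)]; norm_num
      _ ≤ _ := by
        refine Finset.sum_le_sum_of_subset_of_nonneg ?_ ?_
        · intro j; simp; omega
        · intro j _ _
          split_ifs
          · rw [cfun_eq _ _ _ _ hgh]; positivity
          · exact le_rfl
  linarith

lemma lpBound (n k : ℕ) (hk : k ≤ n) (x y : ℕ → ℝ) (hx : ∀ g, g + 1 < n → x g ≤ x (g + 1))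
    (hy : ∀ g, g + 1 < n → y (g + 1) ≤ y g)
    (D : Fin n → Fin n → ℝ) (h0 : ∀ a b, 0 ≤ D a b)
    (hs : ∀ a b, D a b = D b a) (hr : ∀ a, ∑ b, D a b ≤ 1) (ht : ∑ a, ∑ b, D a b ≤ 2 * k) :
    ∑ a : Fin n, ∑ b : Fin n, D a b * ((x b - x a) * (y a - y b)) ≤
      2 * ∑ j ∈ Finset.range k,
        (if j < n - 1 - j then (x (n - 1 - j) - x j) * (y j - y (n - 1 - j)) else 0) := by
  have hL : ∑ a : Fin n, ∑ b : Fin n, D a b * ((x b - x a) * (y a - y b)) =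
      ∑ g ∈ Finset.range (n - 1), ∑ h ∈ Finset.range (n - 1),
      (x (g + 1) - x g) * (y h - y (h + 1)) * ∑ a : Fin n, ∑ b : Fin n, D a b * cfun g h a b := by
    simp only [Finset.mul_sum]
    have e : ∀ a b : Fin n, D a b * ((x b - x a) * (y a - y b)) =
        ∑ g ∈ Finset.range (n - 1), ∑ h ∈ Finset.range (n - 1),
        (x (g + 1) - x g) * (y h - y (h + 1)) * (D a b * cfun g h a b) := by
      intro a b
      rw [prod_expand n x y a b a.2 b.2, Finset.mul_sum]
      refine Finset.sum_congr rfl fun g _ => ?_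
      rw [Finset.mul_sum]
      refine Finset.sum_congr rfl fun h _ => ?_
      ring
    simp only [e]
    have c1 : ∀ a : Fin n, ∑ b : Fin n, ∑ g ∈ Finset.range (n - 1), ∑ h ∈ Finset.range (n - 1),
        (x (g + 1) - x g) * (y h - y (h + 1)) * (D a b * cfun g h a b) =
        ∑ g ∈ Finset.range (n - 1), ∑ h ∈ Finset.range (n - 1), ∑ b : Fin n,
        (x (g + 1) - x g) * (y h - y (h + 1)) * (D a b * cfun g h a b) := by
      intro a
      rw [Finset.sum_comm]
      refine Finset.sum_congr rfl fun g _ => ?_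
      rw [Finset.sum_comm]
    simp only [c1]
    rw [Finset.sum_comm]
    refine Finset.sum_congr rfl fun g _ => ?_
    rw [Finset.sum_comm]
  have hR : ∑ j ∈ Finset.range k,
        (if j < n - 1 - j then (x (n - 1 - j) - x j) * (y j - y (n - 1 - j)) else 0) =
      ∑ g ∈ Finset.range (n - 1), ∑ h ∈ Finset.range (n - 1),
      (x (g + 1) - x g) * (y h - y (h + 1)) *
        ∑ j ∈ Finset.range k, (if j < n - 1 - j then cfun g h j (n - 1 - j) else 0) := by
    simp only [Finset.mul_sum]
    have e : ∀ j ∈ Finset.range k,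
        (if j < n - 1 - j then (x (n - 1 - j) - x j) * (y j - y (n - 1 - j)) else 0) =
        ∑ g ∈ Finset.range (n - 1), ∑ h ∈ Finset.range (n - 1),
        (x (g + 1) - x g) * (y h - y (h + 1)) *
          (if j < n - 1 - j then cfun g h j (n - 1 - j) else 0) := by
      intro j hj
      have := Finset.mem_range.1 hj
      split_ifs with hc
      · exact prod_expand n x y _ _ (by omega) (by omega)
      · simp
    rw [Finset.sum_congr rfl e, Finset.sum_comm]
    refine Finset.sum_congr rfl fun g _ => ?_
    rw [Finset.sum_comm]
  rw [hL, hR, Finset.mul_sum]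
  refine Finset.sum_le_sum fun g hg => ?_
  rw [Finset.mul_sum]
  refine Finset.sum_le_sum fun h hh => ?_
  have hg' := Finset.mem_range.1 hg
  have hh' := Finset.mem_range.1 hh
  have p1 : 0 ≤ (x (g + 1) - x g) * (y h - y (h + 1)) :=
    mul_nonneg (sub_nonneg.2 (hx g (by omega))) (sub_nonneg.2 (hy h (by omega)))
  rw [mul_left_comm]
  refine mul_le_mul_of_nonneg_left ?_ p1
  rcases le_total g h with hc | hc
  · exact lp_count n k hk D h0 hs hr ht g h hc hh'
  · have := lp_count n k hk D h0 hs hr ht h g hc hg'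
    simp only [cfun_swap h g] at this
    exact this

lemma trace_nonneg_sq {n : ℕ} (A : Matrix (Fin n) (Fin n) ℝ) : 0 ≤ (Aᵀ * A).trace := by
  simp only [Matrix.trace, Matrix.diag, Matrix.mul_apply, Matrix.transpose_apply]
  exact Finset.sum_nonneg fun i _ => Finset.sum_nonneg fun j _ => mul_self_nonneg _

lemma trace_diag {n : ℕ} (x y : Fin n → ℝ) (Z : Matrix (Fin n) (Fin n) ℝ) (hZ : Zᵀ = Z) :
    (Z * diagonal x * Z * diagonal y).trace = ∑ a, ∑ b, Z a b ^ 2 * (x b * y a) := by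
  simp only [Matrix.trace, Matrix.diag]
  refine Finset.sum_congr rfl fun a _ => ?_
  rw [Matrix.mul_diagonal, Matrix.mul_apply, Finset.sum_mul]
  refine Finset.sum_congr rfl fun b _ => ?_
  rw [Matrix.mul_diagonal]
  have : Z b a = Z a b := by
    have := congrFun (congrFun hZ a) b
    simpa [Matrix.transpose_apply] using this
  rw [this]; ring

lemma mainTr {n k : ℕ} (β : Fin n → ℝ) (hβ : ∀ a, 0 < β a) (Q : Matrix (Fin n) (Fin n) ℝ)
    (hQ : Qᵀ = Q) (hQQ : Q * Q = Q) (hk : Q.trace = k) :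
    ∃ D : Fin n → Fin n → ℝ, (∀ a b, 0 ≤ D a b) ∧ (∀ a b, D a b = D b a) ∧
      (∀ a, ∑ b, D a b ≤ 1) ∧ (∑ a, ∑ b, D a b ≤ 2 * k) ∧
      ∑ a, ∑ b, Q a b ^ 2 * (β b * (β a)⁻¹) ≤
        k + (1 / 8) * ∑ a, ∑ b, D a b * ((β b - β a) * ((β a)⁻¹ - (β b)⁻¹)) := by
  set Dm : Matrix (Fin n) (Fin n) ℝ := diagonal β with hDm
  set Di : Matrix (Fin n) (Fin n) ℝ := diagonal (fun a => (β a)⁻¹) with hDi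
  set d : Matrix (Fin n) (Fin n) ℝ := diagonal (fun a => Real.sqrt (β a)) with hd
  have hdd : d * d = Dm := by
    rw [hd, hDm, diagonal_mul_diagonal]; congr 1; funext a
    exact Real.mul_self_sqrt (hβ a).le
  have hdT : dᵀ = d := by simp [hd]
  have hDmT : Dmᵀ = Dm := by simp [hDm]
  have hDiT : Diᵀ = Di := by simp [hDi]
  have hmi : Dm * Di = 1 := by
    rw [hDm, hDi, diagonal_mul_diagonal, ← diagonal_one]; congr 1; funext a
    exact mul_inv_cancel₀ (hβ a).ne'
  have him : Di * Dm = 1 := mul_eq_one_comm.1 hmi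
  obtain ⟨Q', C, hQ', hQQ', hM, hC⟩ := exProj ((1 - Q) * Di * Q)
  have o1 : Q * Q' = 0 := by
    rw [hC, ← mul_assoc, ← mul_assoc, ← mul_assoc, mul_sub, mul_one, hQQ, sub_self]; simp
  have o2 : Q' * Q = 0 := by
    have := congrArg Matrix.transpose o1
    rwa [Matrix.transpose_mul, hQ, hQ', Matrix.transpose_zero] at this
  have hrank : Q'.trace ≤ k := by
    rw [trace_eq_rank _ hQQ', ← hk, trace_eq_rank _ hQQ]
    norm_cast
    calc Q'.rank = ((1 - Q) * Di * Q * C).rank := by rw [← hC]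
      _ ≤ ((1 - Q) * Di * Q).rank := Matrix.rank_mul_le_left _ _
      _ ≤ Q.rank := Matrix.rank_mul_le_right _ _
  set Sg := Q + Q' with hSg
  have hSgT : Sgᵀ = Sg := by rw [hSg, Matrix.transpose_add, hQ, hQ']
  have hSgSg : Sg * Sg = Sg := by
    rw [hSg, mul_add, add_mul, add_mul, hQQ, hQQ', o1, o2]; simp
  have sQ : Sg * Q = Q := by rw [hSg, add_mul, hQQ, o2, add_zero]
  have Qs : Q * Sg = Q := by rw [hSg, mul_add, hQQ, o1, add_zero]
  have sDQ : Sg * (Di * Q) = Di * Q := by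
    have e : Di * Q = (1 - Q) * Di * Q + Q * (Di * Q) := by
      rw [sub_mul, sub_mul, one_mul, mul_assoc Q, sub_add_cancel]
    have e2 : Q' * (Di * Q) = (1 - Q) * Di * Q := by
      conv_lhs => rw [e]
      rw [mul_add, hM, ← mul_assoc Q', o2, zero_mul, add_zero]
    rw [hSg, add_mul, e2, add_comm]; exact e.symm
  obtain ⟨K, hKT, sK, Ks, KDs, sDK⟩ := exK Dm Sg hDmT hSgT hSgSg (by
    intro v _ hv
    rw [hDm] at hv
    simp only [dotProduct, Matrix.mulVec_diagonal] at hv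
    rw [Finset.sum_eq_zero_iff_of_nonneg] at hv
    · funext a
      have := hv a (Finset.mem_univ _)
      have h3 : β a * (v a * v a) = 0 := by rw [← this]; ring
      have := (mul_eq_zero.1 h3).resolve_left (hβ a).ne'
      simpa using this
    · intro a _
      have : v a * (β a * v a) = β a * (v a * v a) := by ring
      rw [this]
      exact mul_nonneg (hβ a).le (mul_self_nonneg _))
  have KDK : K * Dm * K = K := by
    calc K * Dm * K = K * Dm * Sg * K := by rw [mul_assoc (K * Dm), sK]
      _ = K := by rw [KDs, sK]
  have KQ : K * Q = Di * Q := by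
    calc K * Q = K * (Dm * Di) * Q := by rw [hmi, mul_one]
      _ = K * Dm * (Di * Q) := by simp only [mul_assoc]
      _ = K * Dm * Sg * (Di * Q) := by rw [mul_assoc _ Sg, sDQ]
      _ = Di * Q := by rw [KDs, sDQ]
  set Z := Q - Q' with hZ
  have hZT : Zᵀ = Z := by rw [hZ, Matrix.transpose_sub, hQ, hQ']
  have hZZ : Z * Z = Sg := by
    rw [hZ, mul_sub, sub_mul, sub_mul, hQQ, hQQ', o1, o2, hSg]; simp
  have hZ2 : Z = (2 : ℝ) • Q - Sg := by
    rw [hZ, hSg, two_smul]; abel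
  set t := (Q * Dm * Q * Di).trace with ht
  have t1 : (Q * Dm * Q * K).trace = t := by
    rw [Matrix.trace_mul_comm, ht, Matrix.trace_mul_comm _ Di]
    congr 1
    rw [mul_assoc Q, ← mul_assoc K, KQ]; simp only [mul_assoc]
  have t2 : (Q * Dm * Sg * K).trace = k := by
    have : Q * Dm * Sg * K = Q := by
      calc _ = Q * Dm * K := by rw [mul_assoc _ Sg, sK]
        _ = Q * (Sg * Dm * K) := by rw [← Qs]; simp only [mul_assoc]; rw [← mul_assoc Sg Sg, hSgSg]
        _ = Q := by rw [sDK, Qs]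
    rw [this, hk]
  have t3 : (Sg * Dm * Q * K).trace = k := by
    rw [Matrix.trace_mul_comm]
    have : K * (Sg * Dm * Q) = Q := by
      calc _ = K * Dm * Q := by simp only [← mul_assoc]; rw [Ks]
        _ = K * Dm * Sg * Q := by rw [mul_assoc _ Sg, sQ]
        _ = Q := by rw [KDs, sQ]
    rw [this, hk]
  have t4 : (Sg * Dm * Sg * K).trace = Sg.trace := by
    rw [mul_assoc _ Sg, sK, sDK]
  have tZK : (Z * Dm * Z * K).trace = 4 * t - 4 * k + Sg.trace := by
    rw [hZ2]
    simp only [sub_mul, mul_sub, Matrix.smul_mul, Matrix.mul_smul, Matrix.trace_sub,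
      Matrix.trace_smul, t1, t2, t3, t4, smul_eq_mul]
    ring
  have hΔ : (Di - K) * Dm * (Di - K) = Di - K := by
    rw [sub_mul, mul_sub, sub_mul, sub_mul, him, one_mul, one_mul, mul_assoc K Dm Di, hmi, mul_one,
      KDK]; simp
  have hge : (Z * Dm * Z * K).trace ≤ (Z * Dm * Z * Di).trace := by
    rw [← sub_nonneg, ← Matrix.trace_sub, ← mul_sub, ← hΔ]
    have h1 := trace_nonneg_sq (d * (Di - K) * Z * d)
    have h2 : (d * (Di - K) * Z * d)ᵀ * (d * (Di - K) * Z * d) =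
        d * (Z * ((Di - K) * Dm * (Di - K)) * Z * d) := by
      simp only [Matrix.transpose_mul, Matrix.transpose_sub, hdT, hDiT, hKT, hZT]
      rw [← hdd]; simp only [mul_assoc]
    rw [h2, Matrix.trace_mul_comm, mul_assoc _ d d, hdd, mul_assoc, mul_assoc,
      Matrix.trace_mul_comm] at h1
    have h3 : (Z * Dm * Z * ((Di - K) * Dm * (Di - K))).trace =
      ((Di - K) * Dm * (Di - K) * (Z * Dm) * Z).trace := by
      rw [Matrix.trace_mul_comm]; simp only [mul_assoc]
    rw [h3]; exact h1
  have hrow : ∀ a, ∑ b, Z a b ^ 2 = Sg a a := by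
    intro a
    rw [← hZZ, Matrix.mul_apply]
    refine Finset.sum_congr rfl fun b _ => ?_
    have : Z b a = Z a b := by
      have := congrFun (congrFun hZT a) b
      simpa [Matrix.transpose_apply] using this
    rw [this]; ring
  have hsym : ∀ a b, Z a b = Z b a := by
    intro a b
    have := congrFun (congrFun hZT b) a
    simpa [Matrix.transpose_apply] using this
  have hSa : ∀ a, Sg a a ≤ 1 := by
    intro a
    have h1 : Sg a a = ∑ b, Sg a b * Sg b a := by
      conv_lhs => rw [← hSgSg]
      rw [Matrix.mul_apply]
    have h2 : Sg a a * Sg a a ≤ Sg a a := by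
      conv_rhs => rw [h1]
      have h4 : ∀ b, Sg a b * Sg b a = Sg a b * Sg a b := by
        intro b
        have := congrFun (congrFun hSgT a) b
        rw [Matrix.transpose_apply] at this
        rw [this]
      simp only [h4]
      exact Finset.single_le_sum (f := fun b => Sg a b * Sg a b)
        (fun b _ => mul_self_nonneg _) (Finset.mem_univ a)
    nlinarith
  have htot : ∑ a, ∑ b, Z a b ^ 2 = Sg.trace := by
    simp only [hrow]; rfl
  have hSgtr : Sg.trace = k + Q'.trace := by rw [hSg, Matrix.trace_add, hk]
  refine ⟨fun a b => Z a b ^ 2, fun a b => sq_nonneg _, fun a b => by show Z a b ^ 2 = Z b a ^ 2; rw [hsym], ?_, ?_, ?_⟩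
  · intro a; rw [hrow]; exact hSa a
  · rw [htot, hSgtr]; linarith
  · have e1 : ∑ a, ∑ b, Q a b ^ 2 * (β b * (β a)⁻¹) = t := by
      rw [ht, hDm, hDi, trace_diag _ _ _ hQ]
    have e2 : (Z * Dm * Z * Di).trace = ∑ a, ∑ b, Z a b ^ 2 * (β b * (β a)⁻¹) := by
      rw [hDm, hDi, trace_diag _ _ _ hZT]
    have e3 : ∑ a, ∑ b, Z a b ^ 2 * (β b * (β a)⁻¹) = ∑ a, ∑ b, Z a b ^ 2 * (β a * (β b)⁻¹) := by
      rw [Finset.sum_comm]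
      refine Finset.sum_congr rfl fun a _ => Finset.sum_congr rfl fun b _ => ?_
      rw [hsym]
    have e4 : ∑ a, ∑ b, Z a b ^ 2 * ((β b - β a) * ((β a)⁻¹ - (β b)⁻¹)) =
        ∑ a, ∑ b, Z a b ^ 2 * (β b * (β a)⁻¹) + ∑ a, ∑ b, Z a b ^ 2 * (β a * (β b)⁻¹)
          - 2 * ∑ a, ∑ b, Z a b ^ 2 := by
      simp only [Finset.mul_sum, ← Finset.sum_add_distrib, ← Finset.sum_sub_distrib]
      refine Finset.sum_congr rfl fun a _ => Finset.sum_congr rfl fun b _ => ?_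
      have := (hβ a).ne'
      have := (hβ b).ne'
      field_simp; ring
    rw [e1, e4, ← e3, htot, ← e2]
    linarith

lemma frobSq_eq {m n : Type*} [Fintype m] [Fintype n] (A : Matrix m n ℝ) :
    frobSq A = ∑ a, ∑ j, A a j ^ 2 := by
  unfold frobSq
  simp only [Matrix.trace, Matrix.diag, Matrix.mul_apply, Matrix.transpose_apply]
  rw [Finset.sum_comm]
  simp only [sq]

lemma frobSq_contr {m n : Type*} [Fintype m] [Fintype n] (C : Matrix m n ℝ) (R : Matrix n n ℝ)
    (hR : Rᵀ = R) (hc : ∀ p : n → ℝ, (R *ᵥ p) ⬝ᵥ (R *ᵥ p) ≤ p ⬝ᵥ p) :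
    frobSq (C * R) ≤ frobSq C := by
  rw [frobSq_eq, frobSq_eq]
  refine Finset.sum_le_sum fun a _ => ?_
  have h := hc (C a)
  have e : ∀ j, (C * R) a j = (R *ᵥ (C a)) j := by
    intro j
    rw [← hR, Matrix.mulVec_transpose, hR]
    rfl
  simp only [e]
  simpa [dotProduct, sq] using h

lemma part2 {n k : ℕ} (W : Matrix (Fin n) (Fin (n + 1)) ℝ) (u0 : Fin (n + 1) → ℝ)
    (β : Fin n → ℝ) (hβ : ∀ a, 0 < β a)
    (hW : Wᵀ * W + vecMulVec u0 u0 = 1)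
    (Q0 G R : Matrix (Fin (n + 1)) (Fin (n + 1)) ℝ) (hQ : Q0ᵀ = Q0) (hQQ : Q0 * Q0 = Q0)
    (hQu : Q0 *ᵥ u0 = 0) (hk : Q0.trace = k) (hQG : Q0 * G = G) (hR : Rᵀ = R)
    (hc : ∀ p : Fin (n + 1) → ℝ, (R *ᵥ p) ⬝ᵥ (R *ᵥ p) ≤ p ⬝ᵥ p)
    (hGR : Q0 * (Wᵀ * diagonal (fun a => (β a)⁻¹) * W) * G = Q0 * R) :
    ∃ Q : Matrix (Fin n) (Fin n) ℝ, Qᵀ = Q ∧ Q * Q = Q ∧ Q.trace = k ∧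
      frobSq (diagonal (fun a => (β a)⁻¹) * W * G) ≤
        ∑ a, ∑ b, Q a b ^ 2 * (β b * (β a)⁻¹) := by
  set Di : Matrix (Fin n) (Fin n) ℝ := diagonal (fun a => (β a)⁻¹) with hDi
  set s : Matrix (Fin n) (Fin n) ℝ := diagonal (fun a => Real.sqrt ((β a)⁻¹)) with hs
  have hss : s * s = Di := by
    rw [hs, hDi, diagonal_mul_diagonal]; congr 1; funext a
    exact Real.mul_self_sqrt (inv_pos.2 (hβ a)).le
  have hsT : sᵀ = s := by simp [hs]
  have hDiT : Diᵀ = Di := by simp [hDi]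
  set M0 := Wᵀ * Di * W with hM0
  have hM0T : M0ᵀ = M0 := by
    simp only [hM0, Matrix.transpose_mul, Matrix.transpose_transpose, hDiT, Matrix.mul_assoc]
  obtain ⟨K, hKT, qK, Kq, KMq, qMK⟩ := exK M0 Q0 hM0T hQ hQQ (by
    intro v hv h0
    have h1 : v ⬝ᵥ M0 *ᵥ v = ∑ a, (β a)⁻¹ * ((W *ᵥ v) a * (W *ᵥ v) a) := by
      rw [hM0, Matrix.mul_assoc, ← Matrix.mulVec_mulVec, ← Matrix.mulVec_mulVec,
        Matrix.dotProduct_mulVec, Matrix.vecMul_transpose, hDi]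
      simp only [dotProduct, Matrix.mulVec_diagonal]
      refine Finset.sum_congr rfl fun a _ => by ring
    rw [h1, Finset.sum_eq_zero_iff_of_nonneg
      (fun a _ => mul_nonneg (inv_pos.2 (hβ a)).le (mul_self_nonneg _))] at h0
    have h2 : W *ᵥ v = 0 := by
      funext a
      have := (mul_eq_zero.1 (h0 a (Finset.mem_univ _))).resolve_left (inv_pos.2 (hβ a)).ne'
      simpa using this
    have h3 : u0 ⬝ᵥ v = 0 := by
      rw [← hv, Matrix.dotProduct_mulVec, ← Matrix.mulVec_transpose, hQ, hQu, zero_dotProduct]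
    have h4 := congrArg (fun M => M *ᵥ v) hW
    simp only [Matrix.add_mulVec, ← Matrix.mulVec_mulVec, h2, Matrix.mulVec_zero,
      Matrix.one_mulVec, zero_add, Matrix.vecMulVec_mulVec, h3] at h4
    rw [← h4]; simp)
  have KMK : K * M0 * K = K := by
    calc K * M0 * K = K * M0 * Q0 * K := by rw [mul_assoc (K * M0), qK]
      _ = K := by rw [KMq, qK]
  have hGK : G = K * R := by
    calc G = Q0 * G := hQG.symm
      _ = K * M0 * Q0 * G := by rw [KMq]
      _ = K * M0 * G := by rw [mul_assoc _ Q0, hQG]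
      _ = K * Q0 * M0 * G := by rw [Kq]
      _ = K * (Q0 * M0 * G) := by simp only [mul_assoc]
      _ = K * R := by rw [hGR, ← mul_assoc, Kq]
  have Ku : K *ᵥ u0 = 0 := by rw [← Kq, ← Matrix.mulVec_mulVec, hQu, Matrix.mulVec_zero]
  set Q := s * W * K * Wᵀ * s with hQd
  refine ⟨Q, ?_, ?_, ?_, ?_⟩
  · simp only [hQd, Matrix.transpose_mul, Matrix.transpose_transpose, hKT, hsT, Matrix.mul_assoc]
  · calc Q * Q = s * W * (K * (Wᵀ * (s * s) * W) * K) * Wᵀ * s := by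
          simp only [hQd, Matrix.mul_assoc]
      _ = Q := by rw [hss, ← hM0, KMK, hQd]
  · calc Q.trace = (s * (W * K * Wᵀ * s)).trace := by simp only [hQd, Matrix.mul_assoc]
      _ = (W * (K * Wᵀ * (s * s))).trace := by
        rw [Matrix.trace_mul_comm]; simp only [Matrix.mul_assoc]
      _ = (K * (Wᵀ * Di * W)).trace := by
        rw [Matrix.trace_mul_comm, hss]; simp only [Matrix.mul_assoc]
      _ = (Q0 * (K * M0)).trace := by rw [← hM0, ← mul_assoc, qK]
      _ = k := by rw [Matrix.trace_mul_comm, KMq, hk]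
  · have h1 : frobSq (Di * W * G) ≤ frobSq (Di * W * K) := by
      rw [hGK, ← Matrix.mul_assoc]; exact frobSq_contr _ _ hR hc
    refine h1.trans (le_of_eq ?_)
    set C := Di * W * K with hC
    have hCu : C *ᵥ u0 = 0 := by rw [hC, ← Matrix.mulVec_mulVec, Ku, Matrix.mulVec_zero]
    have h2 : C * Cᵀ = (C * Wᵀ) * (C * Wᵀ)ᵀ := by
      calc C * Cᵀ = C * (Wᵀ * W + vecMulVec u0 u0) * Cᵀ := by rw [hW, Matrix.mul_one]
        _ = (C * Wᵀ) * (C * Wᵀ)ᵀ := by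
          rw [Matrix.mul_add, Matrix.mul_vecMulVec, hCu, Matrix.zero_vecMulVec, add_zero,
            Matrix.transpose_mul C Wᵀ, Matrix.transpose_transpose]
          simp only [Matrix.mul_assoc]
    have h3 : frobSq C = frobSq (C * Wᵀ) := by
      unfold frobSq
      rw [Matrix.trace_mul_comm, h2, Matrix.trace_mul_comm]
    rw [h3, frobSq_eq]
    refine Finset.sum_congr rfl fun a _ => Finset.sum_congr rfl fun b _ => ?_
    have e1 : (C * Wᵀ) a b = (β a)⁻¹ * (W * K * Wᵀ) a b := by
      rw [hC, hDi]; simp only [Matrix.mul_assoc]; rw [Matrix.diagonal_mul]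
    have e2 : Q a b = Real.sqrt ((β a)⁻¹) * (W * K * Wᵀ) a b * Real.sqrt ((β b)⁻¹) := by
      rw [hQd, hs, Matrix.mul_diagonal]; simp only [Matrix.mul_assoc]; rw [Matrix.diagonal_mul]
    rw [e1, e2, mul_pow, mul_pow, mul_pow, Real.sq_sqrt (inv_pos.2 (hβ a)).le,
      Real.sq_sqrt (inv_pos.2 (hβ b)).le]
    have := (hβ a).ne'
    have := (hβ b).ne'
    field_simp

lemma omega_eq (x : ℝ) (hx : 0 < x) : omegaFn x = (x + 1 / x + 2) / 4 := by
  unfold omegaFn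
  have h1 : Real.sqrt x ≠ 0 := (Real.sqrt_pos.2 hx).ne'
  have h2 : Real.sqrt x ^ 2 = x := Real.sq_sqrt hx.le
  have : (Real.sqrt x + 1 / Real.sqrt x) ^ 2 = Real.sqrt x ^ 2 + 1 / Real.sqrt x ^ 2 + 2 := by
    field_simp; ring
  rw [this, h2]

lemma omega_mono {x y : ℝ} (hx : 1 ≤ x) (hxy : x ≤ y) : omegaFn x ≤ omegaFn y := by
  rw [omega_eq x (by linarith), omega_eq y (by linarith)]
  have hx0 : 0 < x := by linarith
  have hy0 : 0 < y := by linarith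
  have : 1 / x - 1 / y ≤ y - x := by
    rw [div_sub_div _ _ hx0.ne' hy0.ne', div_le_iff₀ (by positivity)]
    nlinarith [mul_nonneg (sub_nonneg.2 hxy) (by nlinarith : 0 ≤ x * y - 1)]
  linarith

lemma part1 {n : ℕ} (W : Matrix (Fin n) (Fin (n + 1)) ℝ) (u0 : Fin (n + 1) → ℝ)
    (β : Fin n → ℝ) (lo hi : ℝ) (hlo : 0 < lo) (hlohi : lo ≤ hi) (hβlo : ∀ a, lo ≤ β a)
    (hβhi : ∀ a, β a ≤ hi)
    (hW : Wᵀ * W + vecMulVec u0 u0 = 1) (hWW : W * Wᵀ = 1) (hWu : W *ᵥ u0 = 0)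
    (hu : u0 ⬝ᵥ u0 = 1)
    (P G R : Matrix (Fin (n + 1)) (Fin (n + 1)) ℝ) (d : Fin (n + 1) → ℝ)
    (hP : Pᵀ = P) (hPP : P * P = P)
    (hPG : P * G = G) (huG : u0 ᵥ* G = 0) (hR : Rᵀ = R)
    (hc : ∀ p : Fin (n + 1) → ℝ, (R *ᵥ p) ⬝ᵥ (R *ᵥ p) ≤ p ⬝ᵥ p)
    (hGR : R = P * (Wᵀ * diagonal (fun a => (β a)⁻¹) * W) * G + vecMulVec (P *ᵥ u0) d)
    (hPu : 0 < (P *ᵥ u0) ⬝ᵥ (P *ᵥ u0)) :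
    (d ⬝ᵥ d) * ((P *ᵥ u0) ⬝ᵥ (P *ᵥ u0)) ≤ omegaFn (hi / lo) := by
  have hβ : ∀ a, 0 < β a := fun a => hlo.trans_le (hβlo a)
  have hhi : 0 < hi := hlo.trans_le hlohi
  set Di : Matrix (Fin n) (Fin n) ℝ := diagonal (fun a => (β a)⁻¹) with hDi
  have hDiT : Diᵀ = Di := by simp [hDi]
  set M := Wᵀ * Di * W + lo⁻¹ • vecMulVec u0 u0 with hM
  have hMT : Mᵀ = M := by
    simp only [hM, Matrix.transpose_add, Matrix.transpose_smul, Matrix.transpose_mul,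
      Matrix.transpose_transpose, hDiT, Matrix.mul_assoc, Matrix.transpose_vecMulVec]
  have hMv : ∀ v, M *ᵥ v = Wᵀ *ᵥ (Di *ᵥ (W *ᵥ v)) + (lo⁻¹ * (u0 ⬝ᵥ v)) • u0 := by
    intro v
    rw [hM, Matrix.add_mulVec, Matrix.mul_assoc, ← Matrix.mulVec_mulVec, ← Matrix.mulVec_mulVec,
      Matrix.smul_mulVec, Matrix.vecMulVec_mulVec, mul_smul]
    simp
  have hsplit : ∀ v w : Fin (n + 1) → ℝ,
      v ⬝ᵥ w = (W *ᵥ v) ⬝ᵥ (W *ᵥ w) + (u0 ⬝ᵥ v) * (u0 ⬝ᵥ w) := by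
    intro v w
    calc v ⬝ᵥ w = v ⬝ᵥ ((Wᵀ * W + vecMulVec u0 u0) *ᵥ w) := by rw [hW, Matrix.one_mulVec]
      _ = _ := by
        rw [Matrix.add_mulVec, dotProduct_add, ← Matrix.mulVec_mulVec, Matrix.dotProduct_mulVec,
          Matrix.vecMul_transpose, Matrix.vecMulVec_mulVec]
        simp [dotProduct_comm v u0, mul_comm]
  have hWM : ∀ v, W *ᵥ (M *ᵥ v) = Di *ᵥ (W *ᵥ v) := by
    intro v
    rw [hMv, Matrix.mulVec_add, Matrix.mulVec_mulVec, hWW, Matrix.one_mulVec, Matrix.mulVec_smul,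
      hWu]; simp
  have huM : ∀ v, u0 ⬝ᵥ (M *ᵥ v) = lo⁻¹ * (u0 ⬝ᵥ v) := by
    intro v
    rw [hMv, dotProduct_add, Matrix.dotProduct_mulVec, Matrix.vecMul_transpose, hWu]
    simp [hu]
  have hvMv : ∀ v, v ⬝ᵥ M *ᵥ v = ∑ a, (β a)⁻¹ * (W *ᵥ v) a ^ 2 + lo⁻¹ * (u0 ⬝ᵥ v) ^ 2 := by
    intro v
    rw [hsplit, hWM, huM, hDi]
    simp only [dotProduct, Matrix.mulVec_diagonal]
    congr 1
    · refine Finset.sum_congr rfl fun a _ => by ring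
    · ring
  have hMM : ∀ v, (M *ᵥ v) ⬝ᵥ (M *ᵥ v) =
      ∑ a, (β a)⁻¹ ^ 2 * (W *ᵥ v) a ^ 2 + lo⁻¹ ^ 2 * (u0 ⬝ᵥ v) ^ 2 := by
    intro v
    rw [hsplit, hWM, huM, hDi]
    simp only [dotProduct, Matrix.mulVec_diagonal]
    congr 1
    · refine Finset.sum_congr rfl fun a _ => by ring
    · ring
  have hvv : ∀ v : Fin (n + 1) → ℝ, v ⬝ᵥ v = ∑ a, (W *ᵥ v) a ^ 2 + (u0 ⬝ᵥ v) ^ 2 := by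
    intro v
    rw [hsplit]
    simp only [dotProduct, sq]
  have hineq : ∀ v, (M *ᵥ v) ⬝ᵥ (M *ᵥ v) ≤
      (lo⁻¹ + hi⁻¹) * (v ⬝ᵥ M *ᵥ v) - lo⁻¹ * hi⁻¹ * (v ⬝ᵥ v) := by
    intro v
    rw [hMM, hvMv, hvv]
    have : ∑ a, (β a)⁻¹ ^ 2 * (W *ᵥ v) a ^ 2 ≤
        (lo⁻¹ + hi⁻¹) * ∑ a, (β a)⁻¹ * (W *ᵥ v) a ^ 2 - lo⁻¹ * hi⁻¹ * ∑ a, (W *ᵥ v) a ^ 2 := by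
      rw [Finset.mul_sum, Finset.mul_sum, ← Finset.sum_sub_distrib]
      refine Finset.sum_le_sum fun a _ => ?_
      have h1 : (β a)⁻¹ ≤ lo⁻¹ := inv_anti₀ hlo (hβlo a)
      have h2 : hi⁻¹ ≤ (β a)⁻¹ := inv_anti₀ (hβ a) (hβhi a)
      nlinarith [mul_nonneg (mul_nonneg (sub_nonneg.2 h1) (sub_nonneg.2 h2))
        (sq_nonneg ((W *ᵥ v) a))]
    nlinarith
  have hdef : ∀ v, v ⬝ᵥ M *ᵥ v = 0 → v = 0 := by
    intro v h0
    have h1 := hineq v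
    have h2 : 0 ≤ (M *ᵥ v) ⬝ᵥ (M *ᵥ v) := by
      simp only [dotProduct]; exact Finset.sum_nonneg fun i _ => mul_self_nonneg _
    have h3 : 0 ≤ v ⬝ᵥ v := by
      simp only [dotProduct]; exact Finset.sum_nonneg fun i _ => mul_self_nonneg _
    have h4 : 0 < lo⁻¹ * hi⁻¹ := by positivity
    rw [h0] at h1
    have : v ⬝ᵥ v = 0 := by nlinarith
    exact dotProduct_self_eq_zero.1 this
  obtain ⟨K, hKT, pK, Kp, KMp, pMK⟩ := exK M P hMT hP hPP (fun v _ h => hdef v h)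
  set p := K *ᵥ u0 with hp
  have hPp : P *ᵥ p = p := by rw [hp, Matrix.mulVec_mulVec, pK]
  have hPMp : P *ᵥ (M *ᵥ p) = P *ᵥ u0 := by
    rw [hp, Matrix.mulVec_mulVec, Matrix.mulVec_mulVec, pMK]
  have hPsym : ∀ v w : Fin (n + 1) → ℝ, (P *ᵥ v) ⬝ᵥ w = v ⬝ᵥ P *ᵥ w := by
    intro v w
    rw [Matrix.dotProduct_mulVec, ← Matrix.mulVec_transpose, hP]
  set σ := p ⬝ᵥ P *ᵥ u0 with hσ
  have hσM : σ = p ⬝ᵥ M *ᵥ p := by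
    rw [hσ, ← hPMp, ← hPsym, hPp]
  have hRp : R *ᵥ p = σ • d := by
    rw [← hR, Matrix.mulVec_transpose, hGR, Matrix.vecMul_add, Matrix.vecMul_vecMulVec]
    have : p ᵥ* (P * (Wᵀ * Di * W) * G) = 0 := by
      have e0 : P * (Wᵀ * Di * W) * G = P * M * P * G := by
        rw [Matrix.mul_assoc _ P G, hPG, hM, Matrix.mul_add, Matrix.add_mul, Matrix.mul_assoc P (_ • _),
          Matrix.smul_mul, Matrix.vecMulVec_mul, huG]; simp
      rw [e0, ← Matrix.vecMul_vecMul, ← Matrix.mulVec_transpose (P * M * P)]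
      have e1 : (P * M * P)ᵀ = P * M * P := by
        simp only [Matrix.transpose_mul, hP, hMT, Matrix.mul_assoc]
      rw [e1, ← Matrix.mulVec_mulVec, ← Matrix.mulVec_mulVec, hPp, hPMp, ← hP,
        Matrix.mulVec_transpose, Matrix.vecMul_vecMul, hPG, huG]
    rw [this, zero_add]
  have h1 := hc p
  rw [hRp, smul_dotProduct, dotProduct_smul, smul_eq_mul, smul_eq_mul] at h1
  have hdd : 0 ≤ d ⬝ᵥ d := by
    simp only [dotProduct]; exact Finset.sum_nonneg fun i _ => mul_self_nonneg _
  have hppn : 0 ≤ p ⬝ᵥ p := by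
    simp only [dotProduct]; exact Finset.sum_nonneg fun i _ => mul_self_nonneg _
  have h2 : (P *ᵥ u0) ⬝ᵥ (P *ᵥ u0) ≤ (M *ᵥ p) ⬝ᵥ (M *ᵥ p) := by
    rw [← hPMp]
    set w := M *ᵥ p
    have e : 0 ≤ (w - P *ᵥ w) ⬝ᵥ (w - P *ᵥ w) := by
      simp only [dotProduct]; exact Finset.sum_nonneg fun i _ => mul_self_nonneg _
    have e2 : (P *ᵥ w) ⬝ᵥ (P *ᵥ w) = w ⬝ᵥ P *ᵥ w := by
      rw [hPsym, Matrix.mulVec_mulVec, hPP]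
    have e3 : (P *ᵥ w) ⬝ᵥ w = w ⬝ᵥ P *ᵥ w := hPsym w w
    rw [sub_dotProduct, dotProduct_sub, dotProduct_sub] at e
    linarith
  have h3 := hineq p
  rw [← hσM] at h3
  have hσ0 : σ ≠ 0 := by
    intro h
    rw [hσM] at h
    have hp0 := hdef p h
    rw [← hPMp, hp0] at hPu
    simp at hPu
  have hr : omegaFn (hi / lo) = (lo⁻¹ + hi⁻¹) ^ 2 / (4 * (lo⁻¹ * hi⁻¹)) := by
    rw [omega_eq _ (by positivity)]; field_simp; ring
  set c := (P *ᵥ u0) ⬝ᵥ (P *ᵥ u0) with hcdef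
  have h5 : 0 < lo⁻¹ * hi⁻¹ := by positivity
  have h4 : (p ⬝ᵥ p) * c ≤ omegaFn (hi / lo) * σ ^ 2 := by
    rw [hr, div_mul_eq_mul_div, le_div_iff₀ (by positivity)]
    set q := p ⬝ᵥ p
    have : q * c ≤ q * ((lo⁻¹ + hi⁻¹) * σ - lo⁻¹ * hi⁻¹ * q) :=
      mul_le_mul_of_nonneg_left (h2.trans h3) hppn
    nlinarith [sq_nonneg ((lo⁻¹ + hi⁻¹) * σ - 2 * (lo⁻¹ * hi⁻¹) * q),
      mul_le_mul_of_nonneg_right this (by positivity : 0 ≤ 4 * (lo⁻¹ * hi⁻¹))]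
  have h6 : 0 < σ ^ 2 := by positivity
  have h7 : σ ^ 2 * ((d ⬝ᵥ d) * c) ≤ σ ^ 2 * omegaFn (hi / lo) := by
    calc σ ^ 2 * ((d ⬝ᵥ d) * c) = (σ * (σ * (d ⬝ᵥ d))) * c := by ring
      _ ≤ (p ⬝ᵥ p) * c := mul_le_mul_of_nonneg_right h1 hPu.le
      _ ≤ _ := by linarith
  exact le_of_mul_le_mul_left h7 h6

lemma core {n : ℕ} (hn : 1 ≤ n) (L : Matrix (Fin (n + 1)) (Fin (n + 1)) ℝ) (hL : Lᵀ = L)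
    (hL1 : L *ᵥ (fun _ => (1 : ℝ)) = 0)
    (lam : Fin (n + 1) → ℝ) (hmono : StrictMono lam) (hlam0 : lam 0 = 0)
    (u : Fin (n + 1) → Fin (n + 1) → ℝ)
    (hortho : ∀ i j, u i ⬝ᵥ u j = if i = j then (1 : ℝ) else 0)
    (heig : ∀ i, L *ᵥ (u i) = lam i • u i)
    (μ : ℝ) (hμ : 0 < μ) (S : Finset (Fin (n + 1))) (hS : S.Nonempty)
    (P : Matrix (Fin (n + 1)) (Fin (n + 1)) ℝ)
    (hPdef : P = diagonal fun j => if j ∈ S then 1 else 0) :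
    ∃ Q : Matrix (Fin n) (Fin n) ℝ, Qᵀ = Q ∧ Q * Q = Q ∧ Q.trace = ((S.card - 1 : ℕ) : ℝ) ∧
      frobSq ((P + μ • L)⁻¹ * P) ≤
        omegaFn (lam (Fin.last n) / lam (Fin.succ ⟨0, hn⟩)) * (((n + 1 : ℕ) : ℝ) / (S.card : ℝ)) +
        ∑ a : Fin n, ∑ b : Fin n, Q a b ^ 2 * (lam b.succ * (lam a.succ)⁻¹) := by
  set W : Matrix (Fin n) (Fin (n + 1)) ℝ := Matrix.of fun a i => u a.succ i with hWd
  set u0 := u 0 with hu0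
  set β : Fin n → ℝ := fun a => lam a.succ with hβd
  have hβ : ∀ a, 0 < β a := by
    intro a; rw [← hlam0]; exact hmono (Fin.succ_pos a)
  have hu : u0 ⬝ᵥ u0 = 1 := by rw [hu0, hortho]; simp
  have hWv : ∀ v a, (W *ᵥ v) a = u a.succ ⬝ᵥ v := fun v a => rfl
  have hWu : W *ᵥ u0 = 0 := by
    funext a; rw [hWv, hu0, hortho]; simp [Fin.succ_ne_zero]
  have hWW : W * Wᵀ = 1 := by
    ext a b
    have : (W * Wᵀ) a b = u a.succ ⬝ᵥ u b.succ := rfl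
    rw [this, hortho, Matrix.one_apply]; simp
  have hW : Wᵀ * W + vecMulVec u0 u0 = 1 := by
    have h1 : (Matrix.of u) * (Matrix.of u)ᵀ = 1 := by
      ext a b
      have : ((Matrix.of u) * (Matrix.of u)ᵀ) a b = u a ⬝ᵥ u b := rfl
      rw [this, hortho, Matrix.one_apply]
    have h2 : (Matrix.of u)ᵀ * (Matrix.of u) = 1 := mul_eq_one_comm.1 h1
    rw [← h2]
    ext i j
    rw [Matrix.add_apply, Matrix.mul_apply, Matrix.mul_apply, Fin.sum_univ_succ, add_comm]
    rfl
  have hLu : L *ᵥ u0 = 0 := by rw [hu0, heig, hlam0, zero_smul]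
  have huL : u0 ᵥ* L = 0 := by rw [← Matrix.mulVec_transpose, hL, hLu]
  have hWL : W * L = diagonal β * W := by
    ext a i
    rw [Matrix.diagonal_mul]
    have e1 : (W * L) a i = (u a.succ ᵥ* L) i := rfl
    rw [e1, ← Matrix.mulVec_transpose, hL, heig]; rfl
  have hLd : L = Wᵀ * (diagonal β * W) := by
    calc L = (Wᵀ * W + vecMulVec u0 u0) * L := by rw [hW, Matrix.one_mul]
      _ = _ := by
        rw [Matrix.add_mul, Matrix.vecMulVec_mul, huL, Matrix.mul_assoc, hWL]; simp
  have hqf : ∀ v, v ⬝ᵥ L *ᵥ v = ∑ a, β a * (W *ᵥ v) a ^ 2 := by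
    intro v
    rw [hLd, ← Matrix.mulVec_mulVec, ← Matrix.mulVec_mulVec, Matrix.dotProduct_mulVec,
      Matrix.vecMul_transpose]
    simp only [dotProduct, Matrix.mulVec_diagonal]
    refine Finset.sum_congr rfl fun a _ => by ring
  have hqf0 : ∀ v, 0 ≤ v ⬝ᵥ L *ᵥ v := by
    intro v; rw [hqf]
    exact Finset.sum_nonneg fun a _ => mul_nonneg (hβ a).le (sq_nonneg _)
  have hdec : ∀ v, W *ᵥ v = 0 → v = (u0 ⬝ᵥ v) • u0 := by
    intro v hv
    have h4 := congrArg (fun M => M *ᵥ v) hW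
    simp only [Matrix.add_mulVec, ← Matrix.mulVec_mulVec, hv, Matrix.mulVec_zero,
      Matrix.one_mulVec, zero_add, Matrix.vecMulVec_mulVec] at h4
    rw [op_smul_eq_smul] at h4
    exact h4.symm
  set one : Fin (n + 1) → ℝ := fun _ => 1 with hone
  have hW1 : W *ᵥ one = 0 := by
    have h1 : (W * L) *ᵥ one = 0 := by rw [← Matrix.mulVec_mulVec, hL1, Matrix.mulVec_zero]
    rw [hWL, ← Matrix.mulVec_mulVec] at h1
    funext a
    have := congrFun h1 a
    rw [Matrix.mulVec_diagonal] at this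
    exact (mul_eq_zero.1 this).resolve_left (hβ a).ne'
  set s := u0 ⬝ᵥ one with hs
  have hones : one = s • u0 := hdec one hW1
  have hss : s * s = ((n + 1 : ℕ) : ℝ) := by
    have h1 : one ⬝ᵥ one = ((n + 1 : ℕ) : ℝ) := by simp [hone, dotProduct]
    rw [← h1]; conv_rhs => rw [hones]
    rw [smul_dotProduct, dotProduct_smul, hu]; simp
  have hs0 : s ≠ 0 := by
    intro h; rw [h] at hss
    have : ((n + 1 : ℕ) : ℝ) ≠ 0 := by positivity
    exact this (by rw [← hss]; simp)
  have hu1 : u0 = s⁻¹ • one := by rw [hones, smul_smul, inv_mul_cancel₀ hs0, one_smul]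
  have hPT : Pᵀ = P := by simp [hPdef]
  have hPP : P * P = P := by
    rw [hPdef, diagonal_mul_diagonal]; congr 1; funext i; split_ifs <;> simp
  have hPsym : ∀ v w : Fin (n + 1) → ℝ, (P *ᵥ v) ⬝ᵥ w = v ⬝ᵥ P *ᵥ w := by
    intro v w
    rw [Matrix.dotProduct_mulVec, ← Matrix.mulVec_transpose, hPT]
  have hPPv : ∀ v : Fin (n + 1) → ℝ, (P *ᵥ v) ⬝ᵥ (P *ᵥ v) = v ⬝ᵥ P *ᵥ v := by
    intro v; rw [hPsym, Matrix.mulVec_mulVec, hPP]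
  have hnn : ∀ v : Fin (n + 1) → ℝ, 0 ≤ v ⬝ᵥ v := by
    intro v
    simp only [dotProduct]; exact Finset.sum_nonneg fun i _ => mul_self_nonneg _
  set A := P + μ • L with hA
  have hAT : Aᵀ = A := by rw [hA, Matrix.transpose_add, Matrix.transpose_smul, hPT, hL]
  have hAq : ∀ v, v ⬝ᵥ A *ᵥ v = (P *ᵥ v) ⬝ᵥ (P *ᵥ v) + μ * (v ⬝ᵥ L *ᵥ v) := by
    intro v
    rw [hA, Matrix.add_mulVec, dotProduct_add, hPPv, Matrix.smul_mulVec, dotProduct_smul,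
      smul_eq_mul]
  have hU : IsUnit A := by
    rw [← Matrix.mulVec_injective_iff_isUnit]
    rw [← Matrix.coe_mulVecLin, injective_iff_map_eq_zero]
    intro v hv
    rw [Matrix.mulVecLin_apply] at hv
    have h1 := hAq v
    rw [hv, dotProduct_zero] at h1
    have h2 := hnn (P *ᵥ v)
    have h3 := mul_nonneg hμ.le (hqf0 v)
    have h4 : P *ᵥ v = 0 := dotProduct_self_eq_zero.1 (by linarith)
    have h5 : v ⬝ᵥ L *ᵥ v = 0 := by
      have : μ * (v ⬝ᵥ L *ᵥ v) = 0 := by linarith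
      exact (mul_eq_zero.1 this).resolve_left hμ.ne'
    rw [hqf, Finset.sum_eq_zero_iff_of_nonneg
      (fun a _ => mul_nonneg (hβ a).le (sq_nonneg _))] at h5
    have h6 : W *ᵥ v = 0 := by
      funext a
      have := (mul_eq_zero.1 (h5 a (Finset.mem_univ _))).resolve_left (hβ a).ne'
      simpa using this
    have h7 := hdec v h6
    rw [hu1, smul_smul] at h7
    set c := s⁻¹ • one ⬝ᵥ v * s⁻¹ with hcd
    obtain ⟨i, hi⟩ := hS
    have h8 := congrFun h4 i
    rw [hPdef, Matrix.mulVec_diagonal, if_pos hi, one_mul] at h8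
    have h9 : ∀ j, v j = v i := by
      intro j; rw [h7]; simp [hone]
    funext j; rw [h9 j, h8]; rfl
  have hdet : IsUnit A.det := (Matrix.isUnit_iff_isUnit_det A).1 hU
  set X := A⁻¹ * P with hX
  have hAX : A * X = P := by rw [hX, ← Matrix.mul_assoc, Matrix.mul_nonsing_inv _ hdet, one_mul]
  set R := P * X with hRd
  set G := L * X with hGd
  have hR : Rᵀ = R := by
    rw [hRd, hX]
    simp only [Matrix.transpose_mul, Matrix.transpose_nonsing_inv, hAT, hPT, Matrix.mul_assoc]
  have hG : G = μ⁻¹ • (P - R) := by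
    have : P - R = μ • G := by
      rw [← hAX, hA, Matrix.add_mul, hRd, hGd, Matrix.smul_mul]; simp
    rw [this, smul_smul, inv_mul_cancel₀ hμ.ne', one_smul]
  have hPG : P * G = G := by
    rw [hG, Matrix.mul_smul, Matrix.mul_sub, hPP, hRd, ← Matrix.mul_assoc, hPP]
  have huG : u0 ᵥ* G = 0 := by
    rw [hGd, ← Matrix.vecMul_vecMul, huL, Matrix.zero_vecMul]
  have hc : ∀ p : Fin (n + 1) → ℝ, (R *ᵥ p) ⬝ᵥ (R *ᵥ p) ≤ p ⬝ᵥ p := by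
    intro p
    set x := X *ᵥ p with hx
    have h1 : A *ᵥ x = P *ᵥ p := by rw [hx, Matrix.mulVec_mulVec, hAX]
    have h2 := hAq x
    have h3 : R *ᵥ p = P *ᵥ x := by rw [hRd, ← Matrix.mulVec_mulVec]
    rw [h3]
    rw [h1, ← hPsym] at h2
    have h4 := mul_nonneg hμ.le (hqf0 x)
    have h5 := hnn (P *ᵥ x - p)
    rw [sub_dotProduct, dotProduct_sub, dotProduct_sub, dotProduct_comm p] at h5
    linarith
  set Di : Matrix (Fin n) (Fin n) ℝ := diagonal (fun a => (β a)⁻¹) with hDi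
  have hWX : W * X = Di * W * G := by
    have h1 : Di * diagonal β = 1 := by
      rw [hDi, diagonal_mul_diagonal, ← diagonal_one]; congr 1; funext a
      exact inv_mul_cancel₀ (hβ a).ne'
    calc W * X = Di * diagonal β * (W * X) := by rw [h1, Matrix.one_mul]
      _ = Di * (diagonal β * W * X) := by simp only [Matrix.mul_assoc]
      _ = Di * W * G := by rw [← hWL, hGd]; simp only [Matrix.mul_assoc]
  set d := u0 ᵥ* X with hd
  have hXd : X = Wᵀ * Di * W * G + vecMulVec u0 d := by
    calc X = (Wᵀ * W + vecMulVec u0 u0) * X := by rw [hW, Matrix.one_mul]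
      _ = _ := by
        rw [Matrix.add_mul, Matrix.vecMulVec_mul, Matrix.mul_assoc, hWX]
        simp only [Matrix.mul_assoc]; rfl
  have hfrob : frobSq X = d ⬝ᵥ d + frobSq (Di * W * G) := by
    rw [← hWX]
    unfold frobSq
    have : Xᵀ * X = vecMulVec d d + (W * X)ᵀ * (W * X) := by
      calc Xᵀ * X = Xᵀ * (Wᵀ * W + vecMulVec u0 u0) * X := by rw [hW, Matrix.mul_one]
        _ = _ := by
          rw [Matrix.mul_add, Matrix.add_mul, Matrix.mul_vecMulVec, Matrix.vecMulVec_mul,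
            Matrix.mulVec_transpose X, Matrix.transpose_mul W X, add_comm (Xᵀ * _ * X)]
          simp only [Matrix.mul_assoc]; rfl
    rw [this, Matrix.trace_add, Matrix.trace_vecMulVec]
  have hGR : R = P * (Wᵀ * Di * W) * G + vecMulVec (P *ᵥ u0) d := by
    rw [hRd]; conv_lhs => rw [hXd]
    rw [Matrix.mul_add, Matrix.mul_vecMulVec]; simp only [Matrix.mul_assoc]
  set e := P *ᵥ one with he
  have hm0 : (0 : ℝ) < S.card := by exact_mod_cast hS.card_pos
  have hee : e ⬝ᵥ e = S.card := by
    rw [he, hPPv, hPdef, hone]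
    simp [dotProduct, Matrix.mulVec_diagonal]
  have he1 : e ⬝ᵥ one = S.card := by
    rw [← hee, he, hPPv, hPsym]
  have hPu : (P *ᵥ u0) ⬝ᵥ (P *ᵥ u0) = S.card / ((n + 1 : ℕ) : ℝ) := by
    rw [hu1, Matrix.mulVec_smul, smul_dotProduct, dotProduct_smul, ← he, hee, ← hss, smul_eq_mul,
      smul_eq_mul]
    rw [div_eq_mul_inv, mul_inv]; ring
  have hN0 : (0 : ℝ) < ((n + 1 : ℕ) : ℝ) := Nat.cast_pos.2 (Nat.succ_pos n)
  have hp1 := part1 W u0 β (lam (Fin.succ ⟨0, hn⟩)) (lam (Fin.last n)) (hβ ⟨0, hn⟩)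
    (hmono.monotone (Fin.le_last _))
    (fun a => hmono.monotone (Fin.succ_le_succ_iff.2 (Fin.mk_le_of_le_val (Nat.zero_le _))))
    (fun a => hmono.monotone (Fin.le_last _)) hW hWW hWu hu P G R d hPT hPP hPG huG hR hc hGR
    (by rw [hPu]; exact div_pos hm0 hN0)
  rw [hPu] at hp1
  set Q0 := P - (S.card : ℝ)⁻¹ • vecMulVec e e with hQ0
  have hPe : P *ᵥ e = e := by rw [he, Matrix.mulVec_mulVec, hPP]
  have heP : e ᵥ* P = e := by rw [← Matrix.mulVec_transpose, hPT, hPe]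
  have hQT : Q0ᵀ = Q0 := by
    rw [hQ0, Matrix.transpose_sub, hPT, Matrix.transpose_smul, Matrix.transpose_vecMulVec]
  have hQP : Q0 * P = Q0 := by
    rw [hQ0, Matrix.sub_mul, hPP, Matrix.smul_mul, Matrix.vecMulVec_mul, heP]
  have hQe : Q0 *ᵥ e = 0 := by
    rw [hQ0, Matrix.sub_mulVec, hPe, Matrix.smul_mulVec, Matrix.vecMulVec_mulVec, hee]
    rw [op_smul_eq_smul, smul_smul, inv_mul_cancel₀ hm0.ne', one_smul, sub_self]
  have hQQ : Q0 * Q0 = Q0 := by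
    conv_lhs => rhs; rw [hQ0]
    rw [Matrix.mul_sub, hQP, Matrix.mul_smul, Matrix.mul_vecMulVec, hQe]; simp
  have hQ1 : Q0 *ᵥ one = 0 := by
    rw [← hQP, ← Matrix.mulVec_mulVec, ← he, hQe]
  have hQu : Q0 *ᵥ u0 = 0 := by rw [hu1, Matrix.mulVec_smul, hQ1, smul_zero]
  have hQtr : Q0.trace = ((S.card - 1 : ℕ) : ℝ) := by
    rw [hQ0, Matrix.trace_sub, Matrix.trace_smul, Matrix.trace_vecMulVec, hee, smul_eq_mul,
      inv_mul_cancel₀ hm0.ne', Nat.cast_sub hS.card_pos, hPdef, Matrix.trace_diagonal]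
    simp
  have hQG : Q0 * G = G := by
    have h1 : e ᵥ* G = 0 := by
      rw [he, ← hPT, Matrix.mulVec_transpose, Matrix.vecMul_vecMul, hPG, hones,
        Matrix.smul_vecMul, huG, smul_zero]
    rw [hQ0, Matrix.sub_mul, hPG, Matrix.smul_mul, Matrix.vecMulVec_mul, h1]; simp
  have hGR2 : Q0 * (Wᵀ * Di * W) * G = Q0 * R := by
    conv_rhs => rw [hGR]
    rw [Matrix.mul_add, Matrix.mul_vecMulVec, Matrix.mulVec_mulVec, hQP, hQu,
      ← Matrix.mul_assoc Q0 (P * _) G, ← Matrix.mul_assoc Q0 P, hQP]; simp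
  obtain ⟨Q, q1, q2, q3, q4⟩ := part2 W u0 β hβ hW Q0 G R hQT hQQ hQu hQtr hQG hR hc hGR2
  refine ⟨Q, q1, q2, q3, ?_⟩
  rw [hfrob]
  refine add_le_add ?_ q4
  rw [← mul_div_assoc, le_div_iff₀ hm0]
  rw [← mul_div_assoc, div_le_iff₀ hN0] at hp1
  exact hp1
/-- Paper's Lemma 2 (`GLR_xi_2_bound_main`): for any nonempty sample set `S` of size `m`
and any `μ > 0`, the GLR full-band noise-sensitivity satisfies
`ξ₂(S) = ‖(P_S + μL)⁻¹ P_S‖_F² ≤ B(m) ≤ r·(N/m + m − 1)`. -/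
theorem stmt_12 (N : ℕ) (hN : 2 ≤ N)
    (G : SimpleGraph (Fin N)) [DecidableRel G.Adj] (hG : G.Connected)
    (lam : Fin N → ℝ) (hmono : StrictMono lam) (hlam0 : lam ⟨0, by omega⟩ = 0)
    (u : Fin N → Fin N → ℝ)
    (hortho : ∀ i j, u i ⬝ᵥ u j = if i = j then (1 : ℝ) else 0)
    (heig : ∀ i, (G.lapMatrix ℝ).mulVec (u i) = lam i • u i)
    (μ : ℝ) (hμ : 0 < μ)
    (S : Finset (Fin N)) (hS : S.Nonempty) :
    let L := G.lapMatrix ℝ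
    let P : Matrix (Fin N) (Fin N) ℝ := Matrix.diagonal fun j => if j ∈ S then 1 else 0
    let m := S.card
    let r := omegaFn (eig1 lam N / eig1 lam 2)
    frobSq ((P + μ • L)⁻¹ * P) ≤ Bfull lam m ∧
    Bfull lam m ≤ r * ((N : ℝ) / (m : ℝ) + (m : ℝ) - 1) := by
  intro L P m r
  obtain ⟨n, rfl⟩ : ∃ n, N = n + 1 := ⟨N - 1, by omega⟩
  have hn : 1 ≤ n := by omega
  have hl0 : lam 0 = 0 := hlam0
  have hm1 : 1 ≤ m := hS.card_pos
  have hmN : m ≤ n + 1 := by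
    have := Finset.card_le_univ S
    simpa using this
  have hxl : ∀ a : Fin n, eig1 lam ((a : ℕ) + 2) = lam a.succ := by
    intro a
    unfold eig1
    rw [dif_pos (by omega)]
    congr 1
  have hxg : ∀ g (hg : g < n), eig1 lam (g + 2) = lam (Fin.succ ⟨g, hg⟩) := fun g hg => hxl ⟨g, hg⟩
  have hpos : ∀ g, g < n → 0 < eig1 lam (g + 2) := by
    intro g hg
    rw [hxg g hg, ← hl0]; exact hmono (Fin.succ_pos _)
  have hle : ∀ g h, g ≤ h → h < n → eig1 lam (g + 2) ≤ eig1 lam (h + 2) := by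
    intro g h hgh hh
    rw [hxg g (by omega), hxg h hh]
    exact hmono.monotone (Fin.succ_le_succ_iff.2 hgh)
  have hlast : eig1 lam (n + 1) = lam (Fin.last n) := by
    unfold eig1
    rw [dif_pos (by omega)]
    congr 1
  have hsum : ∑ i ∈ Finset.Icc 2 m, omegaFn (max 1 (eig1 lam (n + 1 + 2 - i) / eig1 lam i)) =
      ∑ j ∈ Finset.range (m - 1),
        omegaFn (max 1 (eig1 lam ((n - 1 - j) + 2) / eig1 lam (j + 2))) := by
    have e : Finset.Icc 2 m = Finset.Ico 2 (m + 1) := by rfl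
    rw [e, Finset.sum_Ico_eq_sum_range]
    have e2 : m + 1 - 2 = m - 1 := by omega
    rw [e2]
    refine Finset.sum_congr rfl fun j hj => ?_
    have hj' := Finset.mem_range.1 hj
    rw [show n + 1 + 2 - (2 + j) = n - 1 - j + 2 by omega, add_comm 2 j]
  constructor
  · obtain ⟨Q, q1, q2, q3, q4⟩ := core hn L (SimpleGraph.isSymm_lapMatrix ℝ G)
      (SimpleGraph.lapMatrix_mulVec_const_eq_zero G) lam hmono hl0 u hortho heig μ hμ S hS P rfl
    obtain ⟨D, d0, ds, dr, dt, dm⟩ := mainTr (fun a : Fin n => lam a.succ)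
      (fun a => by rw [← hl0]; exact hmono (Fin.succ_pos _)) Q q1 q2 q3
    have hlp := lpBound n (S.card - 1) (by omega) (fun g => eig1 lam (g + 2))
      (fun g => (eig1 lam (g + 2))⁻¹) (fun g hg => hle g (g + 1) (by omega) hg)
      (fun g hg => inv_anti₀ (hpos g (by omega)) (hle g (g + 1) (by omega) hg)) D d0 ds dr dt
    simp only [hxl] at hlp
    have hterm : ∑ j ∈ Finset.range (m - 1),
        omegaFn (max 1 (eig1 lam ((n - 1 - j) + 2) / eig1 lam (j + 2))) =
        ((S.card - 1 : ℕ) : ℝ) + (1 / 4) * ∑ j ∈ Finset.range (S.card - 1),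
          (if j < n - 1 - j then (eig1 lam (n - 1 - j + 2) - eig1 lam (j + 2)) *
            ((eig1 lam (j + 2))⁻¹ - (eig1 lam (n - 1 - j + 2))⁻¹) else 0) := by
      have e1 : ((S.card - 1 : ℕ) : ℝ) = ∑ j ∈ Finset.range (S.card - 1), (1 : ℝ) := by simp
      rw [e1, Finset.mul_sum, ← Finset.sum_add_distrib]
      refine Finset.sum_congr rfl fun j hj => ?_
      have hj' := Finset.mem_range.1 hj
      have hjn : j < n := by omega
      have p1 := hpos j hjn
      have p2 := hpos (n - 1 - j) (by omega)
      split_ifs with h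
      · have h1 := hle j (n - 1 - j) h.le (by omega)
        rw [max_eq_right ((one_le_div p1).2 h1), omega_eq _ (div_pos p2 p1)]
        field_simp
        ring
      · have h1 := hle (n - 1 - j) j (by omega) hjn
        rw [max_eq_left ((div_le_one p1).2 h1), omega_eq 1 one_pos]
        norm_num
    unfold Bfull
    rw [hsum, hterm, hlast, hxg 0 hn]
    refine q4.trans (add_le_add le_rfl (dm.trans ?_))
    linarith
  · unfold Bfull
    rw [hsum]
    have hb : ∀ j ∈ Finset.range (m - 1),
        omegaFn (max 1 (eig1 lam ((n - 1 - j) + 2) / eig1 lam (j + 2))) ≤ r := by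
      intro j hj
      have hj' := Finset.mem_range.1 hj
      have hN' : n + 1 = n - 1 + 2 := by omega
      have p0 := hpos 0 hn
      have p1 := hpos j (by omega)
      have p2 := hpos (n - 1) (by omega)
      have hr : r = omegaFn (eig1 lam (n - 1 + 2) / eig1 lam (0 + 2)) := by
        simp only [r]; rw [← hN']
      rw [hr]
      refine omega_mono (le_max_left _ _) (max_le ?_ ?_)
      · exact (one_le_div p0).2 (hle 0 (n - 1) (by omega) (by omega))
      · exact div_le_div₀ p2.le (hle _ _ (by omega) (by omega)) p0 (hle _ _ (by omega) (by omega))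
    have h2 := Finset.sum_le_sum hb
    rw [Finset.sum_const, Finset.card_range, nsmul_eq_mul, Nat.cast_sub hm1, Nat.cast_one] at h2
    have h3 : r * (((n + 1 : ℕ) : ℝ) / (m : ℝ) + (m : ℝ) - 1) =
        r * (((n + 1 : ℕ) : ℝ) / (m : ℝ)) + ((m : ℝ) - 1) * r := by ring
    rw [h3]
    exact add_le_add le_rfl h2
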